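/- arXiv:1808.09248 — 8 statements merged into one kernel-verified Lean document; each statement's English description precedes it below -/
import Mathlib

section
/- Let α, β, γ be the three distinct complex roots of x³ - x² - x - 1 = 0. Then for every integer n, (T(n) : ℂ) = α^(n+1)/((α-β)(α-γ)) + β^(n+1)/((β-α)(β-γ)) + γ^(n+1)/((γ-α)(γ-β)) (Binet formula for Tribonacci numbers, valid for negative indices as well). -/
/-- Two solutions on `ℤ` of the Tribonacci recurrence that agree at `0`, `1`, `2` are equal. -/
theorem tribonacci_recurrence_unique {R : Type*} [AddCommGroup R] {f g : ℤ → R}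
    (hf : ∀ n, f (n + 3) = f (n + 2) + f (n + 1) + f n)
    (hg : ∀ n, g (n + 3) = g (n + 2) + g (n + 1) + g n)
    (h0 : f 0 = g 0) (h1 : f 1 = g 1) (h2 : f 2 = g 2) (n : ℤ) : f n = g n := by
  suffices h : f n = g n ∧ f (n + 1) = g (n + 1) ∧ f (n + 2) = g (n + 2) from h.1
  induction n using Int.induction_on with
  | zero => exact ⟨h0, by simpa using h1, by simpa using h2⟩
  | succ k ih =>
    obtain ⟨a, b, c⟩ := ih
    refine ⟨b, by rwa [add_assoc], ?_⟩
    rw [add_assoc, show (1 + 2 : ℤ) = 3 by norm_num, hf, hg, a, b, c]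
  | pred k ih =>
    obtain ⟨a, b, c⟩ := ih
    have hf' := hf (-(k : ℤ) - 1)
    have hg' := hg (-(k : ℤ) - 1)
    have s1 : -(k : ℤ) - 1 + 1 = -k := by ring
    have s2 : -(k : ℤ) - 1 + 2 = -k + 1 := by ring
    have s3 : -(k : ℤ) - 1 + 3 = -k + 2 := by ring
    rw [s3, s2, s1] at hf' hg'
    rw [s2, s1]
    rw [c, b, a, hg'] at hf'
    exact ⟨(add_left_cancel hf').symm, a, b⟩

/-- Powers of a nonzero root of `x³ - x² - x - 1` satisfy the Tribonacci recurrence. -/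
theorem zpow_tribonacci_recurrence {K : Type*} [Field K] {x : K} (hx : x ≠ 0)
    (h : x ^ 3 - x ^ 2 - x - 1 = 0) (n : ℤ) :
    x ^ (n + 3) = x ^ (n + 2) + x ^ (n + 1) + x ^ n := by
  rw [zpow_add₀ hx, zpow_add₀ hx, zpow_add₀ hx, zpow_one, zpow_ofNat, zpow_ofNat]
  linear_combination x ^ n * h

/-- Binet formula for the Tribonacci numbers, valid for all integer indices. -/
theorem tribonacci_binet (T : ℤ → ℤ) (hT0 : T 0 = 0) (hT1 : T 1 = 1) (hT2 : T 2 = 1)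
    (hTrec : ∀ n : ℤ, T n = T (n - 1) + T (n - 2) + T (n - 3))
    (α β γ : ℂ) (hαβ : α ≠ β) (hαγ : α ≠ γ) (hβγ : β ≠ γ)
    (hroots : ∀ x : ℂ, (x - α) * (x - β) * (x - γ) = x ^ 3 - x ^ 2 - x - 1)
    (n : ℤ) :
    (T n : ℂ) = α ^ (n + 1) / ((α - β) * (α - γ))
      + β ^ (n + 1) / ((β - α) * (β - γ))
      + γ ^ (n + 1) / ((γ - α) * (γ - β)) := by
  have hprod : α * β * γ = 1 := by linear_combination -hroots 0
  have hsum : α + β + γ = 1 := by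
    linear_combination hroots 0 - (hroots 1 + hroots (-1)) / 2
  have hα : α ≠ 0 := by rintro rfl; simp at hprod
  have hβ : β ≠ 0 := by rintro rfl; simp at hprod
  have hγ : γ ≠ 0 := by rintro rfl; simp at hprod
  have rα := zpow_tribonacci_recurrence hα (by linear_combination -hroots α)
  have rβ := zpow_tribonacci_recurrence hβ (by linear_combination -hroots β)
  have rγ := zpow_tribonacci_recurrence hγ (by linear_combination -hroots γ)
  have d1 := sub_ne_zero.2 hαβ
  have d2 := sub_ne_zero.2 hαγ
  have d3 := sub_ne_zero.2 hβγ
  have e1 : β - α = -(α - β) := by ring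
  have e2 : γ - α = -(α - γ) := by ring
  have e3 : γ - β = -(β - γ) := by ring
  refine tribonacci_recurrence_unique (f := fun n => (T n : ℂ))
    (g := fun n => α ^ (n + 1) / ((α - β) * (α - γ)) + β ^ (n + 1) / ((β - α) * (β - γ))
      + γ ^ (n + 1) / ((γ - α) * (γ - β))) (fun m => ?_) (fun m => ?_) ?_ ?_ ?_ n
  · have h := hTrec (m + 3)
    rw [show m + 3 - 1 = m + 2 by ring, show m + 3 - 2 = m + 1 by ring,
      show m + 3 - 3 = m by ring] at h
    exact_mod_cast h
  · simp only [add_right_comm m _ 1, rα, rβ, rγ]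
    ring
  · simp only [hT0, Int.cast_zero, zero_add, zpow_one]
    rw [e1, e2, e3]
    field_simp
    ring
  · simp only [hT1, Int.cast_one, show (1 + 1 : ℤ) = 2 by norm_num, zpow_ofNat]
    rw [e1, e2, e3]
    field_simp
    ring
  · simp only [hT2, Int.cast_one, show (2 + 1 : ℤ) = 3 by norm_num, zpow_ofNat]
    rw [← hsum, e1, e2, e3]
    field_simp
    ring
end

section
/- Let α, β, γ be the three distinct complex roots of x³ - x² - x - 1 = 0. Then for every integer s, ((α² - α)·K(s) + α·K(s+1) + K(s-1))/((α-γ)(α-β)) = α^s. -/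
/-- For the roots α, β, γ of x³ - x² - x - 1 = 0 and any integer s,
((α² - α)·K(s) + α·K(s+1) + K(s-1))/((α-γ)(α-β)) = α^s. -/
theorem tribonacci_lucas_root_identity (K : ℤ → ℤ) (hK0 : K 0 = 3) (hK1 : K 1 = 1) (hK2 : K 2 = 3)
    (hKrec : ∀ n : ℤ, K n = K (n - 1) + K (n - 2) + K (n - 3))
    (α β γ : ℂ) (hαβ : α ≠ β) (hαγ : α ≠ γ) (hβγ : β ≠ γ)
    (hroots : ∀ x : ℂ, (x - α) * (x - β) * (x - γ) = x ^ 3 - x ^ 2 - x - 1)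
    (s : ℤ) :
    ((α ^ 2 - α) * (K s : ℂ) + α * (K (s + 1) : ℂ) + (K (s - 1) : ℂ))
      / ((α - γ) * (α - β)) = α ^ s := by
  have hα : α ^ 3 - α ^ 2 - α - 1 = 0 := by
    rw [← hroots α]; ring
  have hα0 : α ≠ 0 := by
    rintro rfl
    norm_num at hα
  have hden : (α - γ) * (α - β) ≠ 0 :=
    mul_ne_zero (sub_ne_zero.mpr hαγ) (sub_ne_zero.mpr hαβ)
  -- The denominator is the derivative of the cubic at `α`.
  have hderiv : (α - γ) * (α - β) = 3 * α ^ 2 - 2 * α - 1 := by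
    have hsum : α + β + γ = 1 := by
      linear_combination hroots 0 - hroots 1 / 2 - hroots (-1) / 2
    have hpair : α * β + β * γ + γ * α = -1 := by
      linear_combination hroots 1 / 2 - hroots (-1) / 2
    linear_combination hpair - 2 * α * hsum
  have hKneg : K (-1) = -1 := by
    have h := hKrec 2
    norm_num [hK0, hK1, hK2] at h
    omega
  set N : ℤ → ℂ := fun n ↦ (α ^ 2 - α) * (K n : ℂ) + α * (K (n + 1) : ℂ) + (K (n - 1) : ℂ)
    with hN
  have hstep (n : ℤ) : N (n + 1) = α * N n := by
    have h : (K (n + 1 + 1) : ℂ) = K (n + 1) + K n + K (n - 1) := by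
      have h := hKrec (n + 1 + 1)
      rw [show n + 1 + 1 - 1 = n + 1 by ring, show n + 1 + 1 - 2 = n by ring,
        show n + 1 + 1 - 3 = n - 1 by ring] at h
      exact_mod_cast h
    simp only [hN, add_sub_cancel_right, h]
    linear_combination (-(K n : ℂ)) * hα
  have hpow (n : ℤ) : N n = α ^ n * ((α - γ) * (α - β)) := by
    induction n using Int.induction_on with
    | zero =>
      simp only [hN, hderiv, zpow_zero, zero_add, zero_sub, hK0, hK1, hKneg]
      push_cast
      ring
    | succ n ih =>
      rw [hstep, ih, zpow_add_one₀ hα0]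
      ring
    | pred n ih =>
      have h := hstep (-(n : ℤ) - 1)
      rw [sub_add_cancel, ih] at h
      rw [zpow_sub_one₀ hα0]
      field_simp
      linear_combination -h
  exact (div_eq_iff hden).mpr (hpow s)
end

section
/- For every natural number n, 2·(∑_{i=0}^{n} K(i)) = K(n+2) + K(n), i.e., the sum of the first n+1 Tribonacci-Lucas numbers equals (K(n+2) + K(n))/2. -/
/-- Sum of the first n+1 Tribonacci-Lucas numbers: 2·∑_{i=0}^{n} K(i) = K(n+2) + K(n). -/
theorem tribonacci_lucas_sum (K : ℤ → ℤ) (hK0 : K 0 = 3) (hK1 : K 1 = 1) (hK2 : K 2 = 3)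
    (hKrec : ∀ n : ℤ, K n = K (n - 1) + K (n - 2) + K (n - 3))
    (n : ℕ) :
    2 * (∑ i ∈ Finset.range (n + 1), K i) = K (n + 2) + K n := by
  induction n with
  | zero => simp [hK0, hK2]
  | succ m ih =>
    rw [Finset.sum_range_succ, mul_add, ih]
    have hrec := hKrec (m + 3)
    rw [show (m : ℤ) + 3 - 1 = m + 2 by ring, show (m : ℤ) + 3 - 2 = m + 1 by ring,
      show (m : ℤ) + 3 - 3 = m by ring] at hrec
    push_cast
    rw [show (m : ℤ) + 1 + 2 = m + 3 by ring]
    linarith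
end

section
/- For every natural number n ≥ 1, 2·(∑_{i=1}^{n} T(-i)) = 1 - T(-n-1) - T(-n+1), i.e., the sum of the first n negatively-indexed Tribonacci numbers equals (1 - T(-n-1) - T(-n+1))/2. -/
/-- Sum of the first n negatively-indexed Tribonacci numbers:
2·∑_{i=1}^{n} T(-i) = 1 - T(-n-1) - T(-n+1). -/
theorem tribonacci_neg_sum (T : ℤ → ℤ) (hT0 : T 0 = 0) (hT1 : T 1 = 1) (hT2 : T 2 = 1)
    (hTrec : ∀ n : ℤ, T n = T (n - 1) + T (n - 2) + T (n - 3))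
    (n : ℕ) (hn : 1 ≤ n) :
    2 * (∑ i ∈ Finset.Icc 1 n, T (-(i : ℤ))) = 1 - T (-(n : ℤ) - 1) - T (-(n : ℤ) + 1) := by
  clear hn
  induction n with
  | zero =>
    have h := hTrec 2
    norm_num [hT0, hT1, hT2] at h ⊢
    exact h
  | succ k ih =>
    rw [Finset.sum_Icc_succ_top (by omega), mul_add, ih]
    have h := hTrec (-(k : ℤ) + 1)
    rw [show -(k : ℤ) + 1 - 1 = -k by ring, show -(k : ℤ) + 1 - 2 = -k - 1 by ring,
      show -(k : ℤ) + 1 - 3 = -k - 2 by ring] at h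
    push_cast
    rw [show -((k : ℤ) + 1) = -k - 1 by ring, show -(k : ℤ) - 1 - 1 = -k - 2 by ring,
      show -(k : ℤ) - 1 + 1 = -k by ring]
    linarith
end

section
/- For every natural number n and every integer s, 2·(∑_{i=0}^{n} K(s+i)) = K(n+s+2) + K(n+s) - K(s+1) - K(s-1). (This is the componentwise content of the summation formula for the Tribonacci-Lucas sedenions.) -/
/-- Shifted summation formula for Tribonacci-Lucas numbers:
2·∑_{i=0}^{n} K(s+i) = K(n+s+2) + K(n+s) - K(s+1) - K(s-1). -/
theorem tribonacci_lucas_shifted_sum (K : ℤ → ℤ) (hK0 : K 0 = 3) (hK1 : K 1 = 1) (hK2 : K 2 = 3)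
    (hKrec : ∀ n : ℤ, K n = K (n - 1) + K (n - 2) + K (n - 3))
    (n : ℕ) (s : ℤ) :
    2 * (∑ i ∈ Finset.range (n + 1), K (s + i)) = K (n + s + 2) + K (n + s) - K (s + 1) - K (s - 1) := by
  have step (m : ℤ) : K (m + 2) = K (m + 1) + K m + K (m - 1) := by
    convert hKrec (m + 2) using 3 <;> ring_nf
  induction n with
  | zero =>
    simp only [zero_add, Finset.sum_range_one, Nat.cast_zero, add_zero]
    linarith [step s]
  | succ n ih =>
    rw [Finset.sum_range_succ, mul_add, ih]
    have h := step (n + s + 1)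
    push_cast
    ring_nf at h ⊢
    linarith
end

section
/- Let α, β, γ be the three distinct complex roots of x³ - x² - x - 1 = 0. Then for every natural number n, ∑_{i=0}^{n} C(n,i)·K(i) = (1+α)ⁿ + (1+β)ⁿ + (1+γ)ⁿ, where C(n,i) is the binomial coefficient and the sum is taken in ℂ. -/
/-- The Tribonacci-Lucas numbers are the power sums of the roots of `x³ - x² - x - 1`. -/
theorem tribonacci_lucas_eq_power_sum (K : ℤ → ℤ) (hK0 : K 0 = 3) (hK1 : K 1 = 1) (hK2 : K 2 = 3)
    (hKrec : ∀ n : ℤ, K n = K (n - 1) + K (n - 2) + K (n - 3)) (α β γ : ℂ)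
    (hroots : ∀ x : ℂ, (x - α) * (x - β) * (x - γ) = x ^ 3 - x ^ 2 - x - 1) (n : ℕ) :
    (K n : ℂ) = α ^ n + β ^ n + γ ^ n := by
  have h0 := hroots 0
  have h1 := hroots 1
  have h2 := hroots (-1)
  have hsum : α + β + γ = 1 := by linear_combination -(h1 + h2) / 2 + h0
  have hpair : α * β + α * γ + β * γ = -1 := by linear_combination (h1 - h2) / 2
  have hα : α ^ 3 = α ^ 2 + α + 1 := by linear_combination -hroots α
  have hβ : β ^ 3 = β ^ 2 + β + 1 := by linear_combination -hroots β
  have hγ : γ ^ 3 = γ ^ 2 + γ + 1 := by linear_combination -hroots γ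
  induction n using Nat.strong_induction_on with
  | _ n ih =>
    match n with
    | 0 => norm_num [hK0]
    | 1 => simp [hK1, hsum]
    | 2 =>
      simp only [Nat.cast_ofNat, hK2, Int.cast_ofNat]
      linear_combination -(α + β + γ + 1) * hsum + 2 * hpair
    | m + 3 =>
      have hrec : K ((m + 3 : ℕ) : ℤ) = K ((m + 2 : ℕ) : ℤ) + K ((m + 1 : ℕ) : ℤ) + K (m : ℤ) := by
        convert hKrec ((m + 3 : ℕ) : ℤ) using 3 <;> push_cast <;> ring_nf
      rw [hrec, Int.cast_add, Int.cast_add, ih (m + 2) (by lia), ih (m + 1) (by lia), ih m (by lia)]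
      linear_combination -α ^ m * hα - β ^ m * hβ - γ ^ m * hγ

/-- Binomial sum of Tribonacci-Lucas numbers:
∑_{i=0}^{n} C(n,i)·K(i) = (1+α)ⁿ + (1+β)ⁿ + (1+γ)ⁿ. -/
theorem tribonacci_lucas_binomial_sum (K : ℤ → ℤ) (hK0 : K 0 = 3) (hK1 : K 1 = 1) (hK2 : K 2 = 3)
    (hKrec : ∀ n : ℤ, K n = K (n - 1) + K (n - 2) + K (n - 3))
    (α β γ : ℂ) (hαβ : α ≠ β) (hαγ : α ≠ γ) (hβγ : β ≠ γ)
    (hroots : ∀ x : ℂ, (x - α) * (x - β) * (x - γ) = x ^ 3 - x ^ 2 - x - 1)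
    (n : ℕ) :
    (∑ i ∈ Finset.range (n + 1), (n.choose i : ℂ) * (K i : ℂ))
      = (1 + α) ^ n + (1 + β) ^ n + (1 + γ) ^ n := by
  simp_rw [tribonacci_lucas_eq_power_sum K hK0 hK1 hK2 hKrec α β γ hroots, add_comm (1 : ℂ),
    add_pow, one_pow, mul_one, ← Finset.sum_add_distrib]
  exact Finset.sum_congr rfl fun i _ => by ring
end

section
/- For all integers m and n, T(m+n) = T(m-1)·T(n+2) + (T(m-2) + T(m-3))·T(n+1) + T(m-2)·T(n). (In particular this holds for n ≥ 0 and m ≥ 3, and componentwise it yields the sedenion addition formula T̂_{m+n} = T(m-1)·T̂_{n+2} + (T(m-2)+T(m-3))·T̂_{n+1} + T(m-2)·T̂_n.) -/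
/-- A bi-infinite sequence satisfying the Tribonacci recurrence and vanishing at three consecutive
indices is identically zero. -/
theorem eq_zero_of_tribonacci_rec (D : ℤ → ℤ) (h0 : D 0 = 0) (h1 : D 1 = 0) (h2 : D 2 = 0)
    (hrec : ∀ k : ℤ, D (k + 3) = D (k + 2) + D (k + 1) + D k) (k : ℤ) : D k = 0 := by
  suffices h : D k = 0 ∧ D (k + 1) = 0 ∧ D (k + 2) = 0 from h.1
  induction k using Int.induction_on with
  | zero => exact ⟨h0, h1, h2⟩
  | succ i ih =>
    have hi := hrec i
    rw [show (i : ℤ) + 1 + 1 = i + 2 by ring, show (i : ℤ) + 1 + 2 = i + 3 by ring]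
    refine ⟨ih.2.1, ih.2.2, ?_⟩
    linarith [ih.1, ih.2.1, ih.2.2]
  | pred i ih =>
    have hi := hrec (-i - 1)
    rw [show -(i : ℤ) - 1 + 3 = -i + 2 by ring, show -(i : ℤ) - 1 + 2 = -i + 1 by ring,
      show -(i : ℤ) - 1 + 1 = -i by ring] at hi
    rw [show -(i : ℤ) - 1 + 2 = -i + 1 by ring, show -(i : ℤ) - 1 + 1 = -i by ring]
    refine ⟨?_, ih.1, ih.2.1⟩
    linarith [ih.1, ih.2.1, ih.2.2]

/-- Addition formula for Tribonacci numbers: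
T(m+n) = T(m-1)·T(n+2) + (T(m-2)+T(m-3))·T(n+1) + T(m-2)·T(n). -/
theorem tribonacci_addition_formula (T : ℤ → ℤ) (hT0 : T 0 = 0) (hT1 : T 1 = 1) (hT2 : T 2 = 1)
    (hTrec : ∀ n : ℤ, T n = T (n - 1) + T (n - 2) + T (n - 3))
    (m n : ℤ) :
    T (m + n) = T (m - 1) * T (n + 2) + (T (m - 2) + T (m - 3)) * T (n + 1)
      + T (m - 2) * T n := by
  have hrec (k : ℤ) : T (k + 3) = T (k + 2) + T (k + 1) + T k := by
    have h := hTrec (k + 3)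
    rwa [show k + 3 - 1 = k + 2 by ring, show k + 3 - 2 = k + 1 by ring,
      show k + 3 - 3 = k by ring] at h
  have hneg1 : T (-1) = 0 := by
    have h := hrec (-1)
    norm_num [hT0, hT1, hT2] at h
    exact h
  have hneg2 : T (-2) = 1 := by
    have h := hrec (-2)
    norm_num [hT0, hT1, hneg1] at h
    exact h.symm
  have key := eq_zero_of_tribonacci_rec
    (fun k => T (k + (n + 1)) -
      (T k * T (n + 2) + (T (k - 1) + T (k - 2)) * T (n + 1) + T (k - 1) * T n))
    (by simp [hT0, hneg1, hneg2])
    (by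
      have e : 1 + (n + 1) = n + 2 := by ring
      simp [e, hT0, hT1, hneg1])
    (by
      have e : 2 + (n + 1) = n + 3 := by ring
      simp [e, hT0, hT1, hT2, hrec n])
    (fun k => by
      have a := hrec (k + (n + 1))
      have b := hrec k
      have c := hrec (k - 1)
      have d := hrec (k - 2)
      ring_nf at a b c d ⊢
      rw [a, b, c, d]
      ring)
    (m - 1)
  have h := sub_eq_zero.mp key
  rwa [show m - 1 + (n + 1) = m + n by ring, show m - 1 - 1 = m - 2 by ring,
    show m - 1 - 2 = m - 3 by ring] at h
end

section
/- For all integers m and n, K(m+n) = K(n-1)·T(m+2) + (T(m+1) + T(m))·K(n-2) + K(n-3)·T(m+1). (In particular this holds for n ≥ 0 and m ≥ 3, and componentwise it yields the sedenion addition formula K̂_{m+n} = K(n-1)·T̂_{m+2} + (T̂_{m+1}+T̂_m)·K(n-2) + K(n-3)·T̂_{m+1}.) -/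
/-- Two integer-indexed sequences satisfying the Tribonacci recurrence and agreeing at three
consecutive indices are equal. -/
theorem eq_of_tribonacci_recurrence {A : Type*} [AddCommGroup A] {f g : ℤ → A}
    (hf : ∀ n, f n = f (n - 1) + f (n - 2) + f (n - 3))
    (hg : ∀ n, g n = g (n - 1) + g (n - 2) + g (n - 3))
    {a : ℤ} (h₀ : f a = g a) (h₁ : f (a - 1) = g (a - 1)) (h₂ : f (a - 2) = g (a - 2)) :
    f = g := by
  suffices h : ∀ k : ℤ, f k = g k ∧ f (k - 1) = g (k - 1) ∧ f (k - 2) = g (k - 2) from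
    funext fun k => (h k).1
  intro k
  induction k using Int.inductionOn' (b := a) with
  | zero => exact ⟨h₀, h₁, h₂⟩
  | succ k _ ih =>
    obtain ⟨ih₀, ih₁, ih₂⟩ := ih
    have e₁ : k + 1 - 1 = k := by ring
    have e₂ : k + 1 - 2 = k - 1 := by ring
    have e₃ : k + 1 - 3 = k - 2 := by ring
    refine ⟨?_, by rwa [e₁], by rwa [e₂]⟩
    rw [hf, hg, e₁, e₂, e₃, ih₀, ih₁, ih₂]
  | pred k _ ih =>
    obtain ⟨ih₀, ih₁, ih₂⟩ := ih
    have e₁ : k - 1 - 1 = k - 2 := by ring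
    have e₂ : k - 1 - 2 = k - 3 := by ring
    refine ⟨ih₁, by rwa [e₁], ?_⟩
    rw [hf, hg, ih₁, ih₂] at ih₀
    rw [e₂]
    exact add_left_cancel ih₀

/-- Addition formula relating Tribonacci-Lucas and Tribonacci numbers:
K(m+n) = K(n-1)·T(m+2) + (T(m+1)+T(m))·K(n-2) + K(n-3)·T(m+1). -/
theorem tribonacci_lucas_addition_formula (T : ℤ → ℤ) (hT0 : T 0 = 0) (hT1 : T 1 = 1) (hT2 : T 2 = 1)
    (hTrec : ∀ n : ℤ, T n = T (n - 1) + T (n - 2) + T (n - 3))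
    (K : ℤ → ℤ) (hK0 : K 0 = 3) (hK1 : K 1 = 1) (hK2 : K 2 = 3)
    (hKrec : ∀ n : ℤ, K n = K (n - 1) + K (n - 2) + K (n - 3))
    (m n : ℤ) :
    K (m + n) = K (n - 1) * T (m + 2) + (T (m + 1) + T m) * K (n - 2)
      + K (n - 3) * T (m + 1) := by
  have hTneg₁ : T (-1) = 0 := by
    have h := hTrec 2
    norm_num at h
    lia
  have hTneg₂ : T (-2) = 1 := by
    have h := hTrec 1
    norm_num at h
    lia
  refine congrFun (eq_of_tribonacci_recurrence (f := fun m => K (m + n))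
    (g := fun m => K (n - 1) * T (m + 2) + (T (m + 1) + T m) * K (n - 2) + K (n - 3) * T (m + 1))
    (a := 0) (fun k => ?_) (fun k => ?_) ?_ ?_ ?_) m
  · have h := hKrec (k + n)
    simpa only [add_sub_right_comm] using h
  · have h₀ := hTrec k
    have h₁ := hTrec (k + 1)
    have h₂ := hTrec (k + 2)
    simp only [add_sub_right_comm] at h₁ h₂
    simp only [h₀, h₁, h₂]
    ring
  · simp [hT0, hT1, hT2, hKrec n]
  · simp [hT0, hT1, hTneg₁, neg_add_eq_sub]
  · simp [hT0, hTneg₁, hTneg₂, neg_add_eq_sub]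
end
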